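/- Let ν, μ > 0, α₁, α₂ ∈ ℝ, M > 0 and 0 ≤ δ ≤ 1/2. Let v₀ : ℝ³ → ℝ³ be a Schwartz vector field whose Fourier transform v̂₀ is supported in {ξ : 1−δ ≤ |ξ| ≤ 1+δ} and satisfies ∫_{ℝ³} |v̂₀(ξ)| dξ ≤ M. Let f and g be the solutions of ∂ₜf = νΔf, f(0,·) = α₁ v₀ and ∂ₜg = μΔg, g(0,·) = α₂ v₀. Then there exists a constant C > 0, depending only on ν, μ, α₁ and α₂, such that ∫₀^∞ ∫_{ℝ³} | 𝓕( f(t,·) × g(t,·) )(ξ) | dξ dt ≤ C M² δ. -/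

import Mathlib

open MeasureTheory
open scoped ENNReal

noncomputable section

abbrev R3 := EuclideanSpace ℝ (Fin 3)
abbrev C3 := EuclideanSpace ℂ (Fin 3)

def mkR3 (f : Fin 3 → ℝ) : R3 := (WithLp.equiv 2 (Fin 3 → ℝ)).symm f
def mkC3 (f : Fin 3 → ℂ) : C3 := (WithLp.equiv 2 (Fin 3 → ℂ)).symm f

/-- Fourier transform with the convention `f̂(ξ) = ∫ e^{-i x·ξ} f(x) dx`. -/
def FT (f : R3 → ℂ) (ξ : R3) : ℂ :=
  ∫ x : R3, Complex.exp (-(Complex.I * ((inner ℝ x ξ : ℝ) : ℂ))) * f x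

/-- Componentwise Fourier transform of a vector field. -/
def vFT (u : R3 → R3) (ξ : R3) : C3 := mkC3 fun i => FT (fun x => ((u x i : ℝ) : ℂ)) ξ

/-- Cross product on `ℝ³`. -/
def crossR (a b : R3) : R3 :=
  mkR3 ![a 1 * b 2 - a 2 * b 1, a 2 * b 0 - a 0 * b 2, a 0 * b 1 - a 1 * b 0]

/-- The solution of the heat equation `∂ₜ f = ν Δ f` with initial data `v`, given for `t > 0`
by convolution with the Gaussian heat kernel. -/
def heatSol (ν : ℝ) (v : R3 → R3) (t : ℝ) (x : R3) : R3 :=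
  if t ≤ 0 then v x
  else mkR3 fun i =>
    ∫ y : R3, (4 * Real.pi * ν * t) ^ (-(3:ℝ)/2) * Real.exp (-‖x - y‖ ^ 2 / (4 * ν * t)) * v y i

open scoped FourierTransform

lemma aux_selfadj {f g : R3 → ℂ} (hf : Integrable f) (hg : Integrable g) :
    ∫ ξ, 𝓕 f ξ * g ξ = ∫ x, f x * 𝓕 g x := by
  have := VectorFourier.integral_fourierIntegral_smul_eq_flip (μ := (volume : Measure R3))
    (ν := (volume : Measure R3)) (L := innerₗ R3)
    Real.continuous_fourierChar continuous_inner hf hg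
  rw [flip_innerₗ] at this
  exact this

lemma aux_prod {f ψ : R3 → ℂ} (hf : Integrable f) (hψ : Integrable ψ) (ξ : R3) :
    𝓕 (fun x => f x * 𝓕⁻ ψ x) ξ = ∫ η, 𝓕 f (ξ - η) * ψ η := by
  have hF : Integrable (fun x => Complex.exp (((-2 * Real.pi * inner ℝ x ξ : ℝ) : ℂ) * Complex.I) * f x) := by
    refine hf.bdd_mul (c := 1) ?_ ?_
    · exact Continuous.aestronglyMeasurable (by fun_prop)
    · exact Filter.Eventually.of_forall fun x => (Complex.norm_exp_ofReal_mul_I _).le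
  have h1 := aux_selfadj hF hψ.comp_neg
  rw [← Real.fourierInv_eq_fourier_comp_neg] at h1
  rw [Real.fourier_eq']
  simp only [smul_eq_mul]
  simp only [mul_assoc] at h1 ⊢
  rw [← h1, ← integral_neg_eq_self]
  congr 1; ext η
  rw [neg_neg]
  congr 1
  simp only [Real.fourier_eq', smul_eq_mul, ← mul_assoc, ← Complex.exp_add]
  congr 1; ext x
  congr 2
  rw [inner_neg_right, inner_sub_right]
  push_cast; ring

lemma aux_gauss_int {b : ℝ} (hb : 0 < b) (x : R3) :
    Integrable (fun η : R3 => Complex.exp (-(b:ℂ) * ‖η‖ ^ 2 + 2 * Real.pi * Complex.I * (inner ℝ x η : ℝ))) := by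
  have := GaussianFourier.integrable_cexp_neg_mul_sq_norm_add (V := R3) (b := (b:ℂ)) (by simpa using hb) (2 * Real.pi * Complex.I) x
  simpa using this

lemma aux_heat {ν t : ℝ} (hν : 0 < ν) (ht : 0 < t) {u : R3 → ℂ} (hu : Integrable u) (x : R3) :
    ∫ y : R3, (((4 * Real.pi * ν * t) ^ (-(3:ℝ)/2) * Real.exp (-‖x - y‖ ^ 2 / (4 * ν * t)) : ℝ) : ℂ) * u y
      = 𝓕⁻ (fun η => ((Real.exp (-(4 * Real.pi ^ 2 * ν * t) * ‖η‖ ^ 2) : ℝ) : ℂ) * 𝓕 u η) x := by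
  have hb : 0 < 4 * Real.pi ^ 2 * ν * t := by positivity
  have h1 := aux_selfadj (aux_gauss_int hb x) hu
  rw [Real.fourierInv_eq']
  simp only [smul_eq_mul]
  trans ∫ ξ, 𝓕 (fun η : R3 => Complex.exp (-((4 * Real.pi ^ 2 * ν * t : ℝ):ℂ) * ‖η‖ ^ 2 + 2 * Real.pi * Complex.I * (inner ℝ x η : ℝ))) ξ * u ξ
  · congr 1; ext y
    rw [fourier_gaussian_innerProductSpace' (by rw [Complex.ofReal_re]; exact hb)]
    congr 1
    push_cast
    congr 1
    · rw [show (Real.pi : ℂ) / (4 * Real.pi ^ 2 * ν * t) = ((4 * Real.pi * ν * t : ℝ) : ℂ)⁻¹ by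
        push_cast; field_simp]
      rw [show ((Module.finrank ℝ R3 : ℂ) / 2) = ((3/2 : ℝ) : ℂ) by simp]
      rw [← Complex.ofReal_inv, ← Complex.ofReal_cpow (by positivity)]
      rw [Real.inv_rpow (by positivity), ← Real.rpow_neg (by positivity)]
      norm_num
    · congr 1
      field_simp
  · rw [h1]
    congr 1; ext η
    rw [← mul_assoc]
    congr 1
    rw [Complex.ofReal_exp, ← Complex.exp_add]
    congr 1
    rw [real_inner_comm]
    push_cast
    ring

lemma aux_heat_int {ν t : ℝ} (hν : 0 < ν) (ht : 0 < t) {u : R3 → ℂ} (hu : Integrable u) :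
    Integrable (fun x => ∫ y : R3, (((4 * Real.pi * ν * t) ^ (-(3:ℝ)/2) * Real.exp (-‖x - y‖ ^ 2 / (4 * ν * t)) : ℝ) : ℂ) * u y) := by
  have hb : 0 < 1 / (4 * ν * t) := by positivity
  have hK : Integrable (fun x : R3 => (((4 * Real.pi * ν * t) ^ (-(3:ℝ)/2) * Real.exp (-‖x‖ ^ 2 / (4 * ν * t)) : ℝ) : ℂ)) := by
    have := (aux_gauss_int hb 0).const_mul (((4 * Real.pi * ν * t) ^ (-(3:ℝ)/2) : ℝ) : ℂ)
    refine this.congr (Filter.Eventually.of_forall fun x => ?_)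
    simp only [inner_zero_left, Complex.ofReal_zero, mul_zero, add_zero]
    push_cast
    congr 2
    ring
  have := hu.integrable_convolution (ContinuousLinearMap.mul ℂ ℂ) hK
  refine this.congr (Filter.Eventually.of_forall fun x => ?_)
  simp only [convolution_def, ContinuousLinearMap.mul_apply']
  congr 1; ext y; ring

/-- FT of heat flow -/
lemma aux_heat_fourier {ν t : ℝ} (hν : 0 < ν) (ht : 0 < t) {u : R3 → ℂ} (hu : Integrable u)
    (hu' : Integrable (𝓕 u)) (hc : Continuous (𝓕 u)) :
    let φ : R3 → ℂ := fun η => ((Real.exp (-(4 * Real.pi ^ 2 * ν * t) * ‖η‖ ^ 2) : ℝ) : ℂ) * 𝓕 u η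
    Continuous φ ∧ Integrable φ ∧ Integrable (𝓕⁻ φ) ∧ 𝓕 (𝓕⁻ φ) = φ := by
  intro φ
  have h1 : Continuous φ := by
    simp only [φ]; fun_prop
  have h2 : Integrable φ := by
    refine hu'.bdd_mul (c := 1) (Continuous.aestronglyMeasurable (by fun_prop)) ?_
    refine Filter.Eventually.of_forall fun x => ?_
    rw [Complex.norm_real, Real.norm_eq_abs, Real.abs_exp, Real.exp_le_one_iff]
    have : 0 ≤ (4 * Real.pi ^ 2 * ν * t) * ‖x‖ ^ 2 := by positivity
    linarith
  have h3 : Integrable (𝓕⁻ φ) := by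
    refine (aux_heat_int hν ht hu).congr (Filter.Eventually.of_forall fun x => ?_)
    exact aux_heat hν ht hu x
  refine ⟨h1, h2, h3, h1.fourier_fourierInv_eq h2 ?_⟩
  have : 𝓕 φ = fun x => 𝓕⁻ φ (-x) := by
    ext x; rw [Real.fourierInv_eq_fourier_neg, neg_neg]
  rw [this]
  exact h3.comp_neg

lemma aux_exp_diff (x y : ℝ) (c : ℝ) (hx : x ≤ c) (hy : y ≤ c) :
    |Real.exp x - Real.exp y| ≤ |x - y| * Real.exp c := by
  wlog h : y ≤ x generalizing x y
  · rw [abs_sub_comm, abs_sub_comm x]; exact this y x hy hx (le_of_not_ge h)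
  rw [abs_of_nonneg (by simpa using h), abs_of_nonneg (by linarith)]
  have h1 := Real.add_one_le_exp (y - x)
  have h2 : Real.exp y = Real.exp x * Real.exp (y - x) := by rw [← Real.exp_add]; ring_nf
  have h3 : Real.exp x ≤ Real.exp c := Real.exp_le_exp.2 hx
  have h4 := Real.exp_pos x
  calc Real.exp x - Real.exp y = Real.exp x * (1 - Real.exp (y - x)) := by rw [h2]; ring
    _ ≤ Real.exp x * (x - y) := mul_le_mul_of_nonneg_left (by linarith) h4.le
    _ ≤ Real.exp c * (x - y) := mul_le_mul_of_nonneg_right h3 (by linarith)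
    _ = _ := mul_comm _ _

lemma aux_D {ν μ δ t a b : ℝ} (hν : 0 < ν) (hμ : 0 < μ) (ht : 0 < t) (h0 : 0 ≤ δ) (h1 : δ ≤ 1/2)
    (ha : 1 - δ ≤ a) (ha' : a ≤ 1 + δ) (hb : 1 - δ ≤ b) (hb' : b ≤ 1 + δ) :
    |Real.exp (-(ν * t) * a ^ 2) * Real.exp (-(μ * t) * b ^ 2) -
      Real.exp (-(ν * t) * b ^ 2) * Real.exp (-(μ * t) * a ^ 2)| ≤
      4 * |ν - μ| * δ * (t * Real.exp (-(min ν μ / 2 * t))) := by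
  rw [← Real.exp_add, ← Real.exp_add]
  have hm : 0 < min ν μ := lt_min hν hμ
  have hmν : min ν μ ≤ ν := min_le_left _ _
  have hmμ : min ν μ ≤ μ := min_le_right _ _
  set m := min ν μ
  have hA : 1 / 4 ≤ a ^ 2 := by nlinarith
  have hB : 1 / 4 ≤ b ^ 2 := by nlinarith
  have key : ∀ p q : ℝ, 1/4 ≤ p → 1/4 ≤ q → -(ν * t) * p + -(μ * t) * q ≤ -(m / 2 * t) := by
    intro p q hp hq
    have e1 : m * (1/4) ≤ ν * p := by gcongr
    have e2 : m * (1/4) ≤ μ * q := by gcongr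
    nlinarith
  refine (aux_exp_diff _ _ _ (key _ _ hA hB) (key _ _ hB hA)).trans ?_
  have : |-(ν * t) * a ^ 2 + -(μ * t) * b ^ 2 - (-(ν * t) * b ^ 2 + -(μ * t) * a ^ 2)|
      = |ν - μ| * t * |a ^ 2 - b ^ 2| := by
    rw [show -(ν * t) * a ^ 2 + -(μ * t) * b ^ 2 - (-(ν * t) * b ^ 2 + -(μ * t) * a ^ 2)
      = -((ν - μ) * t * (a^2 - b^2)) by ring, abs_neg, abs_mul, abs_mul, abs_of_pos ht]
  rw [this]
  have h5 : |a ^ 2 - b ^ 2| ≤ 4 * δ := by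
    rw [abs_le]; constructor <;> nlinarith
  calc |ν - μ| * t * |a ^ 2 - b ^ 2| * Real.exp (-(m / 2 * t))
      ≤ |ν - μ| * t * (4 * δ) * Real.exp (-(m / 2 * t)) := by gcongr
    _ = _ := by ring

lemma aux_FT (h : R3 → ℂ) (ξ : R3) : FT h ξ = 𝓕 h ((2 * Real.pi)⁻¹ • ξ) := by
  rw [Real.fourier_eq', FT]
  congr 1; ext x
  rw [smul_eq_mul, inner_smul_right]
  congr 2
  push_cast
  have : (Real.pi : ℂ) ≠ 0 := by exact_mod_cast Real.pi_ne_zero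
  field_simp

lemma aux_scale (F : R3 → ℝ≥0∞) :
    ∫⁻ ξ, F ((2 * Real.pi)⁻¹ • ξ) = ENNReal.ofReal ((2 * Real.pi) ^ 3) * ∫⁻ ξ, F ξ := by
  have hr : (2 * Real.pi)⁻¹ ≠ 0 := by positivity
  have h := (Homeomorph.smulOfNeZero (α := R3) _ hr).measurableEmbedding.lintegral_map F
    (μ := volume)
  have h2 := Measure.map_addHaar_smul (volume : Measure R3) hr
  simp only [Homeomorph.smulOfNeZero_apply] at h
  change ∫⁻ a, F a ∂(Measure.map (fun x => (2 * Real.pi)⁻¹ • x) volume) = _ at h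
  rw [← h, h2, lintegral_smul_measure]
  have e : |((2 * Real.pi)⁻¹ ^ Module.finrank ℝ R3)⁻¹| = (2 * Real.pi) ^ 3 := by
    rw [abs_of_pos (by positivity), inv_pow, inv_inv]; simp
  rw [e, smul_eq_mul]

lemma aux_bdd (f : R3 → ℂ) (x : R3) : ‖𝓕 f x‖ ≤ ∫ y, ‖f y‖ :=
  VectorFourier.norm_fourierIntegral_le_integral_norm _ _ _ _ _

lemma aux_cont {f : R3 → ℂ} (hf : Integrable f) : Continuous (𝓕 f) :=
  VectorFourier.fourierIntegral_continuous Real.continuous_fourierChar continuous_inner hf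

lemma aux_cont_inv {f : R3 → ℂ} (hf : Integrable f) : Continuous (𝓕⁻ f) := by
  rw [Real.fourierInv_eq_fourier_comp_neg]
  exact aux_cont hf.comp_neg

lemma aux_mul_int {f ψ : R3 → ℂ} (hf : Integrable f) (hψ : Integrable ψ) :
    Integrable (fun x => f x * 𝓕⁻ ψ x) := by
  refine hf.mul_bdd (c := ∫ y, ‖ψ (-y)‖) (aux_cont_inv hψ).aestronglyMeasurable ?_
  refine Filter.Eventually.of_forall fun x => ?_
  rw [Real.fourierInv_eq_fourier_comp_neg]
  exact aux_bdd _ _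

lemma aux_conv_int {f ψ : R3 → ℂ} (hf : Integrable f) (hψ : Integrable ψ) (ξ : R3) :
    Integrable (fun η => 𝓕 f (ξ - η) * ψ η) := by
  refine hψ.bdd_mul (c := ∫ y, ‖f y‖) ?_ ?_
  · exact ((aux_cont hf).comp (continuous_const.sub continuous_id)).aestronglyMeasurable
  · exact Filter.Eventually.of_forall fun x => aux_bdd _ _

lemma aux_fourier_sub {f g : R3 → ℂ} (hf : Integrable f) (hg : Integrable g) (ξ : R3) :
    𝓕 (fun x => f x - g x) ξ = 𝓕 f ξ - 𝓕 g ξ := by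
  simp only [Real.fourier_eq]
  rw [← integral_sub ((Real.fourierIntegral_convergent_iff ξ).2 hf)
    ((Real.fourierIntegral_convergent_iff ξ).2 hg)]
  simp only [smul_sub]

/-- Gaussian multiplier times FT -/
def gm (ν t : ℝ) (u : R3 → ℂ) : R3 → ℂ :=
  fun η => ((Real.exp (-(4 * Real.pi ^ 2 * ν * t) * ‖η‖ ^ 2) : ℝ) : ℂ) * 𝓕 u η

lemma aux_cross {ν μ t : ℝ} (hν : 0 < ν) (hμ : 0 < μ) (ht : 0 < t) {u w : R3 → ℂ}
    (hu : Integrable u) (hu' : Integrable (𝓕 u)) (hw : Integrable w) (hw' : Integrable (𝓕 w))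
    (ξ : R3) :
    𝓕 (fun x => 𝓕⁻ (gm ν t u) x * 𝓕⁻ (gm μ t w) x - 𝓕⁻ (gm ν t w) x * 𝓕⁻ (gm μ t u) x) ξ
    = ∫ η, (gm ν t u (ξ - η) * gm μ t w η - gm ν t w η * gm μ t u (ξ - η)) := by
  obtain ⟨-, a2, a3, a4⟩ := aux_heat_fourier hν ht hu hu' (aux_cont hu)
  obtain ⟨-, b2, b3, b4⟩ := aux_heat_fourier hν ht hw hw' (aux_cont hw)
  obtain ⟨-, c2, c3, c4⟩ := aux_heat_fourier hμ ht hu hu' (aux_cont hu)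
  obtain ⟨-, d2, d3, d4⟩ := aux_heat_fourier hμ ht hw hw' (aux_cont hw)
  change Integrable (gm ν t u) at a2
  change Integrable (𝓕⁻ (gm ν t u)) at a3
  change 𝓕 (𝓕⁻ (gm ν t u)) = gm ν t u at a4
  change Integrable (gm ν t w) at b2
  change Integrable (𝓕⁻ (gm ν t w)) at b3
  change 𝓕 (𝓕⁻ (gm ν t w)) = gm ν t w at b4
  change Integrable (gm μ t u) at c2
  change Integrable (𝓕⁻ (gm μ t u)) at c3
  change 𝓕 (𝓕⁻ (gm μ t u)) = gm μ t u at c4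
  change Integrable (gm μ t w) at d2
  have i1 := aux_conv_int a3 d2 ξ
  have i2 := aux_conv_int c3 b2 ξ
  rw [a4] at i1
  rw [c4] at i2
  rw [aux_fourier_sub (aux_mul_int a3 d2) (aux_mul_int b3 c2), aux_prod a3 d2, a4]
  simp only [mul_comm (𝓕⁻ (gm ν t w) _)]
  rw [aux_prod c3 b2, c4, ← integral_sub i1 i2]
  simp only [mul_comm (gm ν t w _)]

lemma aux_cross_bound {ν μ t δ : ℝ} (hν : 0 < ν) (hμ : 0 < μ) (ht : 0 < t) (h0 : 0 ≤ δ) (h1 : δ ≤ 1/2)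
    {u w : R3 → ℂ}
    (hu : Integrable u) (hu' : Integrable (𝓕 u)) (hw : Integrable w) (hw' : Integrable (𝓕 w))
    (su : ∀ η, 𝓕 u η ≠ 0 → 1 - δ ≤ 2 * Real.pi * ‖η‖ ∧ 2 * Real.pi * ‖η‖ ≤ 1 + δ)
    (sw : ∀ η, 𝓕 w η ≠ 0 → 1 - δ ≤ 2 * Real.pi * ‖η‖ ∧ 2 * Real.pi * ‖η‖ ≤ 1 + δ) :
    ∫⁻ ξ, ‖𝓕 (fun x => 𝓕⁻ (gm ν t u) x * 𝓕⁻ (gm μ t w) x - 𝓕⁻ (gm ν t w) x * 𝓕⁻ (gm μ t u) x) ξ‖ₑ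
    ≤ ENNReal.ofReal (4 * |ν - μ| * δ * (t * Real.exp (-(min ν μ / 2 * t)))) *
      ((∫⁻ η, ‖𝓕 u η‖ₑ) * ∫⁻ η, ‖𝓕 w η‖ₑ) := by
  set D := 4 * |ν - μ| * δ * (t * Real.exp (-(min ν μ / 2 * t)))
  have hcu := aux_cont hu
  have hcw := aux_cont hw
  have hpt : ∀ a b : R3, ‖gm ν t u a * gm μ t w b - gm ν t w b * gm μ t u a‖ₑ ≤
      ENNReal.ofReal D * (‖𝓕 u a‖ₑ * ‖𝓕 w b‖ₑ) := by
    intro a b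
    by_cases hA : 𝓕 u a = 0
    · simp [gm, hA]
    by_cases hB : 𝓕 w b = 0
    · simp [gm, hB]
    have hD := aux_D hν hμ ht h0 h1 (su a hA).1 (su a hA).2 (sw b hB).1 (sw b hB).2
    have e : gm ν t u a * gm μ t w b - gm ν t w b * gm μ t u a =
      ((Real.exp (-(ν * t) * (2 * Real.pi * ‖a‖) ^ 2) * Real.exp (-(μ * t) * (2 * Real.pi * ‖b‖) ^ 2) -
      Real.exp (-(ν * t) * (2 * Real.pi * ‖b‖) ^ 2) * Real.exp (-(μ * t) * (2 * Real.pi * ‖a‖) ^ 2) : ℝ) : ℂ)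
       * (𝓕 u a * 𝓕 w b) := by
      simp only [gm]
      simp only [show ∀ (κ : ℝ) (c : R3), -(κ * t) * (2 * Real.pi * ‖c‖) ^ 2 = -(4 * Real.pi ^ 2 * κ * t) * ‖c‖ ^ 2 by
        intros; ring]
      push_cast
      ring
    rw [e, enorm_mul, enorm_mul]
    gcongr
    rw [← ofReal_norm, Complex.norm_real, Real.norm_eq_abs]
    exact ENNReal.ofReal_le_ofReal hD
  have mu : Measurable fun η => ‖𝓕 u η‖ₑ := hcu.measurable.enorm
  have mw : Measurable fun η => ‖𝓕 w η‖ₑ := hcw.measurable.enorm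
  calc _ ≤ ∫⁻ ξ, ∫⁻ η, ENNReal.ofReal D * (‖𝓕 u (ξ - η)‖ₑ * ‖𝓕 w η‖ₑ) := by
        refine lintegral_mono fun ξ => ?_
        rw [aux_cross hν hμ ht hu hu' hw hw']
        refine (enorm_integral_le_lintegral_enorm _).trans (lintegral_mono fun η => hpt _ _)
    _ = ∫⁻ η, ∫⁻ ξ, ENNReal.ofReal D * (‖𝓕 u (ξ - η)‖ₑ * ‖𝓕 w η‖ₑ) := by
        apply lintegral_lintegral_swap
        apply Measurable.aemeasurable
        have q1 : Measurable fun p : R3 × R3 => ‖𝓕 u (p.1 - p.2)‖ₑ :=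
          mu.comp (measurable_fst.sub measurable_snd)
        have q2 : Measurable fun p : R3 × R3 => ‖𝓕 w p.2‖ₑ := mw.comp measurable_snd
        exact (q1.mul q2).const_mul _
    _ = ∫⁻ η, ENNReal.ofReal D * ((∫⁻ ξ, ‖𝓕 u ξ‖ₑ) * ‖𝓕 w η‖ₑ) := by
        congr 1; ext η
        rw [lintegral_const_mul' _ _ ENNReal.ofReal_ne_top, lintegral_mul_const' _ _ enorm_ne_top,
          lintegral_sub_right_eq_self (fun ξ => ‖𝓕 u ξ‖ₑ)]
    _ = _ := by
        rw [lintegral_const_mul' _ _ ENNReal.ofReal_ne_top, lintegral_const_mul _ mw]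

/-- complexified component -/
def cc (v : R3 → R3) (i : Fin 3) : R3 → ℂ := fun x => ((v x i : ℝ) : ℂ)

lemma aux_heatSol {ν t : ℝ} (hν : 0 < ν) (ht : 0 < t) (α : ℝ) (v : R3 → R3) (i : Fin 3)
    (hv : Integrable (cc v i)) (x : R3) :
    ((heatSol ν (α • v) t x i : ℝ) : ℂ) = α * 𝓕⁻ (gm ν t (cc v i)) x := by
  have h := aux_heat hν ht hv x
  change _ = 𝓕⁻ (gm ν t (cc v i)) x at h
  rw [← h, heatSol, if_neg (not_le.2 ht)]
  simp only [mkR3, WithLp.equiv_symm_apply]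
  rw [← integral_complex_ofReal, ← integral_const_mul]
  congr 1; ext y
  simp only [cc, Pi.smul_apply, PiLp.smul_apply, smul_eq_mul]
  push_cast
  ring

lemma aux_int_exp {m : ℝ} (hm : 0 < m) :
    ∫⁻ t in Set.Ioi (0:ℝ), ENNReal.ofReal (t * Real.exp (-(m * t))) = ENNReal.ofReal (1 / m ^ 2) := by
  have h := Real.integral_rpow_mul_exp_neg_mul_Ioi (a := 2) (by norm_num) hm
  have e : ∀ t : ℝ, t ^ ((2:ℝ) - 1) * Real.exp (-(m * t)) = t * Real.exp (-(m * t)) := by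
    intro t; norm_num
  simp only [e] at h
  have hpos : 0 < 1 / m ^ 2 := by positivity
  have hG : (1 / m) ^ (2:ℝ) * Real.Gamma 2 = 1 / m ^ 2 := by
    rw [Real.Gamma_two, mul_one, Real.rpow_two, div_pow, one_pow]
  rw [hG] at h
  rw [← h, ofReal_integral_eq_lintegral_ofReal]
  · by_contra hn
    rw [integral_undef hn] at h
    linarith
  · filter_upwards [ae_restrict_mem measurableSet_Ioi] with t ht
    have : 0 < t := ht
    positivity

lemma aux_norm_le (z : C3) : ‖z‖ₑ ≤ ‖z 0‖ₑ + ‖z 1‖ₑ + ‖z 2‖ₑ := by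
  have : ‖z‖ ≤ ‖z 0‖ + ‖z 1‖ + ‖z 2‖ := by
    rw [EuclideanSpace.norm_eq, Fin.sum_univ_three]
    apply Real.sqrt_le_iff.2
    have := norm_nonneg (z 0)
    have := norm_nonneg (z 1)
    have := norm_nonneg (z 2)
    constructor
    · positivity
    · nlinarith [mul_nonneg (norm_nonneg (z 0)) (norm_nonneg (z 1)), mul_nonneg (norm_nonneg (z 0)) (norm_nonneg (z 2)), mul_nonneg (norm_nonneg (z 1)) (norm_nonneg (z 2))]
  simp only [← ofReal_norm]
  rw [← ENNReal.ofReal_add (by positivity) (by positivity), ← ENNReal.ofReal_add (by positivity) (by positivity)]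
  exact ENNReal.ofReal_le_ofReal this

lemma aux_vFT (v : R3 → R3) (ξ : R3) (i : Fin 3) : vFT v ξ i = 𝓕 (cc v i) ((2 * Real.pi)⁻¹ • ξ) := by
  rw [← aux_FT]; rfl

lemma aux_fourier_const (c : ℂ) (f : R3 → ℂ) (ξ : R3) :
    𝓕 (fun x => c * f x) ξ = c * 𝓕 f ξ := by
  simp only [Real.fourier_eq', smul_eq_mul]
  rw [← integral_const_mul]
  congr 1; ext x; ring

lemma aux_meas (f : R3 → ℂ) : Measurable (𝓕 f) := by
  by_cases hf : Integrable f
  · exact (aux_cont hf).measurable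
  · have : 𝓕 f = 0 := by
      ext ξ
      rw [Real.fourier_eq, integral_undef]
      · rfl
      · rwa [Real.fourierIntegral_convergent_iff]
    rw [this]; exact measurable_zero

lemma aux_vmeas (v : R3 → R3) (i : Fin 3) : Measurable fun ξ => ‖vFT v ξ i‖ₑ := by
  simp only [aux_vFT]
  exact ((aux_meas _).comp (measurable_const_smul _)).enorm

lemma aux_main {ν μ α₁ α₂ M δ t : ℝ} (hν : 0 < ν) (hμ : 0 < μ) (v₀ : SchwartzMap R3 R3)
    (hM : 0 < M) (h0 : 0 ≤ δ) (h1 : δ ≤ 1/2)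
    (hs : ∀ ξ : R3, vFT (⇑v₀) ξ ≠ 0 → 1 - δ ≤ ‖ξ‖ ∧ ‖ξ‖ ≤ 1 + δ)
    (hI : (∫⁻ ξ : R3, (‖vFT (⇑v₀) ξ‖₊ : ℝ≥0∞)) ≤ ENNReal.ofReal M) (ht : 0 < t) :
    (∫⁻ ξ : R3, (‖vFT (fun x =>
        crossR (heatSol ν (α₁ • ⇑v₀) t x) (heatSol μ (α₂ • ⇑v₀) t x)) ξ‖₊ : ℝ≥0∞)) ≤
      ENNReal.ofReal (3 * (2 * Real.pi) ^ 3 * |α₁ * α₂| * (4 * |ν - μ|) * M ^ 2 * δ) *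
        ENNReal.ofReal (t * Real.exp (-(min ν μ / 2 * t))) := by
  have hpi : 0 < 2 * Real.pi := by positivity
  have hc : ∀ i, Continuous (cc v₀ i) := fun i => by
    have := v₀.continuous
    unfold cc; fun_prop
  have hu : ∀ i, Integrable (cc v₀ i) := fun i => by
    refine (v₀.integrable (μ := volume)).mono (hc i).aestronglyMeasurable ?_
    refine Filter.Eventually.of_forall fun x => ?_
    rw [cc, Complex.norm_real]
    exact PiLp.norm_apply_le _ _
  have hcF : ∀ i, Continuous (𝓕 (cc v₀ i)) := fun i => aux_cont (hu i)
  have hL : ∀ i, ∫⁻ η, ‖𝓕 (cc v₀ i) η‖ₑ ≤ ENNReal.ofReal M := fun i => by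
    calc ∫⁻ η, ‖𝓕 (cc v₀ i) η‖ₑ ≤ ENNReal.ofReal ((2 * Real.pi) ^ 3) * ∫⁻ η, ‖𝓕 (cc v₀ i) η‖ₑ := by
          refine le_mul_of_one_le_left' ?_
          rw [ENNReal.one_le_ofReal]
          exact one_le_pow₀ (by linarith [Real.pi_gt_three])
      _ = ∫⁻ ξ, ‖vFT v₀ ξ i‖ₑ := by
          rw [← aux_scale (fun η => ‖𝓕 (cc v₀ i) η‖ₑ)]
          simp only [aux_vFT]
      _ ≤ ∫⁻ ξ, ‖vFT v₀ ξ‖ₑ := by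
          refine lintegral_mono fun ξ => ?_
          exact enorm_le_iff_norm_le.2 (PiLp.norm_apply_le _ _)
      _ ≤ _ := hI
  have hu' : ∀ i, Integrable (𝓕 (cc v₀ i)) := fun i =>
    ⟨(hcF i).aestronglyMeasurable, (hL i).trans_lt ENNReal.ofReal_lt_top⟩
  have su : ∀ i η, 𝓕 (cc v₀ i) η ≠ 0 → 1 - δ ≤ 2 * Real.pi * ‖η‖ ∧ 2 * Real.pi * ‖η‖ ≤ 1 + δ := by
    intro i η hη
    have := hs ((2 * Real.pi) • η) (fun h => hη ?_)
    · rwa [norm_smul, Real.norm_eq_abs, abs_of_pos hpi] at this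
    · have h2 := aux_vFT v₀ ((2 * Real.pi) • η) i
      rw [h, smul_smul, inv_mul_cancel₀ hpi.ne', one_smul] at h2
      rw [← h2]; rfl
  set D := 4 * |ν - μ| * δ * (t * Real.exp (-(min ν μ / 2 * t))) with hD
  have comp : ∀ (k i j : Fin 3), (∀ a b : R3, crossR a b k = a i * b j - a j * b i) →
      ∫⁻ ξ, ‖vFT (fun x => crossR (heatSol ν (α₁ • ⇑v₀) t x) (heatSol μ (α₂ • ⇑v₀) t x)) ξ k‖ₑ ≤
      ENNReal.ofReal ((2 * Real.pi) ^ 3 * (|α₁ * α₂| * (D * (M * M)))) := by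
    intro k i j hk
    simp only [aux_vFT]
    rw [aux_scale (fun η => ‖𝓕 (cc (fun x => crossR (heatSol ν (α₁ • ⇑v₀) t x) (heatSol μ (α₂ • ⇑v₀) t x)) k) η‖ₑ)]
    have e : cc (fun x => crossR (heatSol ν (α₁ • ⇑v₀) t x) (heatSol μ (α₂ • ⇑v₀) t x)) k
      = fun x => ((α₁ * α₂ : ℝ) : ℂ) * (𝓕⁻ (gm ν t (cc v₀ i)) x * 𝓕⁻ (gm μ t (cc v₀ j)) x - 𝓕⁻ (gm ν t (cc v₀ j)) x * 𝓕⁻ (gm μ t (cc v₀ i)) x) := by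
      ext x
      rw [cc, hk]
      push_cast
      rw [aux_heatSol hν ht _ _ _ (hu i), aux_heatSol hν ht _ _ _ (hu j),
        aux_heatSol hμ ht _ _ _ (hu i), aux_heatSol hμ ht _ _ _ (hu j)]
      ring
    rw [e]
    simp only [aux_fourier_const, enorm_mul]
    rw [lintegral_const_mul' _ _ enorm_ne_top, ENNReal.ofReal_mul (by positivity), ENNReal.ofReal_mul (p := |α₁ * α₂|) (by positivity), ENNReal.ofReal_mul (p := D) (by positivity), ENNReal.ofReal_mul (p := M) (by positivity)]
    gcongr
    · rw [← ofReal_norm, Complex.norm_real, Real.norm_eq_abs]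
    · refine (aux_cross_bound hν hμ ht h0 h1 (hu i) (hu' i) (hu j) (hu' j) (su i) (su j)).trans ?_
      gcongr
      · exact hL i
      · exact hL j
  have c0 := comp 0 1 2 (fun a b => by simp [crossR, mkR3])
  have c1 := comp 1 2 0 (fun a b => by simp [crossR, mkR3])
  have c2 := comp 2 0 1 (fun a b => by simp [crossR, mkR3])
  calc _ ≤ ∫⁻ ξ, (‖vFT (fun x => crossR (heatSol ν (α₁ • ⇑v₀) t x) (heatSol μ (α₂ • ⇑v₀) t x)) ξ 0‖ₑ
        + ‖vFT (fun x => crossR (heatSol ν (α₁ • ⇑v₀) t x) (heatSol μ (α₂ • ⇑v₀) t x)) ξ 1‖ₑ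
        + ‖vFT (fun x => crossR (heatSol ν (α₁ • ⇑v₀) t x) (heatSol μ (α₂ • ⇑v₀) t x)) ξ 2‖ₑ) :=
        lintegral_mono fun ξ => aux_norm_le _
    _ ≤ _ := by
        rw [lintegral_add_right _ (aux_vmeas _ _), lintegral_add_right _ (aux_vmeas _ _)]
        refine (add_le_add (add_le_add c0 c1) c2).trans (le_of_eq ?_)
        rw [← ENNReal.ofReal_add (by positivity) (by positivity),
          ← ENNReal.ofReal_add (by positivity) (by positivity), ← ENNReal.ofReal_mul (by positivity)]
        congr 1
        rw [hD]; ring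

/-- **Smallness of the cross term of two heat flows of proportional annulus-supported data.**
Let `f, g` be the heat flows with diffusivities `ν, μ` of `α₁ v₀, α₂ v₀`, where `v₀` is a
Schwartz field with `supp v̂₀ ⊆ {1−δ ≤ |ξ| ≤ 1+δ}` (`0 ≤ δ ≤ 1/2`) and `∫|v̂₀| ≤ M`. Then
`∫₀^∞ ∫ |𝓕(f(t)×g(t))(ξ)| dξ dt ≤ C M² δ`, with `C` depending only on `ν, μ, α₁, α₂`. -/
theorem cross_term_estimate (ν μ α₁ α₂ : ℝ) (hν : 0 < ν) (hμ : 0 < μ) :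
    ∃ C : ℝ, 0 < C ∧
      ∀ (M δ : ℝ) (v₀ : SchwartzMap R3 R3), 0 < M → 0 ≤ δ → δ ≤ 1 / 2 →
        (∀ ξ : R3, vFT (⇑v₀) ξ ≠ 0 → 1 - δ ≤ ‖ξ‖ ∧ ‖ξ‖ ≤ 1 + δ) →
        (∫⁻ ξ : R3, (‖vFT (⇑v₀) ξ‖₊ : ℝ≥0∞)) ≤ ENNReal.ofReal M →
        (∫⁻ t in Set.Ioi (0 : ℝ), ∫⁻ ξ : R3,
            (‖vFT (fun x =>
                crossR (heatSol ν (α₁ • ⇑v₀) t x) (heatSol μ (α₂ • ⇑v₀) t x)) ξ‖₊ : ℝ≥0∞)) ≤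
          ENNReal.ofReal (C * M ^ 2 * δ) := by
  have hm : 0 < min ν μ / 2 := by have := lt_min hν hμ; linarith
  set K := 3 * (2 * Real.pi) ^ 3 * |α₁ * α₂| * (4 * |ν - μ|) * (1 / (min ν μ / 2) ^ 2) with hK
  have hK0 : 0 ≤ K := by positivity
  refine ⟨K + 1, by linarith, ?_⟩
  intro M δ v₀ hM h0 h1 hs hI
  refine (setLIntegral_mono' measurableSet_Ioi
    (fun t ht => aux_main (α₁ := α₁) (α₂ := α₂) hν hμ v₀ hM h0 h1 hs hI ht)).trans ?_
  rw [lintegral_const_mul' _ _ ENNReal.ofReal_ne_top, aux_int_exp hm,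
    ← ENNReal.ofReal_mul (by positivity)]
  apply ENNReal.ofReal_le_ofReal
  have h2 : 0 ≤ M ^ 2 * δ := by positivity
  rw [show 3 * (2 * Real.pi) ^ 3 * |α₁ * α₂| * (4 * |ν - μ|) * M ^ 2 * δ * (1 / (min ν μ / 2) ^ 2)
    = K * (M ^ 2 * δ) by rw [hK]; ring]
  linarith [show (K + 1) * M ^ 2 * δ = K * (M ^ 2 * δ) + M ^ 2 * δ by ring]
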